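/- Let Π be a closed and strictly positive set of distributions on {0,1}^p, let r be a quota rule and f a logical connection, and suppose condition κ4 fails. Then there exists a constant c > 0, depending only on Π, q, d, and f, such that for every n ≥ 1 for which both condition κ1(n) and condition κ2(n) fail, DP^max(n) ≥ c. -/

import Mathlib

/-- A judgement on `p` premises: a vector in `{0,1}^p`, encoded as `Fin p → Bool`. -/
abbrev Judg (p : ℕ) : Type := Fin p → Bool

noncomputable section

/-- `Ω_i`: for a premise index `i < p`, the set of judgements whose `i`-th premise is `1`;
for the conclusion index `i = p`, the set of judgements `ω` with `f ω = 1`. -/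
def Omega (p : ℕ) (f : Judg p → Bool) (i : Fin (p + 1)) : Finset (Judg p) :=
  if h : (i : ℕ) < p then Finset.univ.filter (fun ω => ω ⟨(i : ℕ), h⟩ = true)
  else Finset.univ.filter (fun ω => f ω = true)

/-- The vector `c_i ∈ ℝ^({0,1}^p)`: `c_i(ω) = q_i - 1` if `ω ∈ Ω_i`, else `q_i`. -/
def cvec (p : ℕ) (f : Judg p → Bool) (q : Fin (p + 1) → ℝ) (i : Fin (p + 1)) :
    Judg p → ℝ :=
  fun ω => if ω ∈ Omega p f i then q i - 1 else q i

/-- Euclidean inner product on `ℝ^({0,1}^p)`. -/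
def inn (p : ℕ) (u v : Judg p → ℝ) : ℝ := ∑ ω : Judg p, u ω * v ω

/-- The histogram of a profile: how many agents cast each judgement. -/
def Hist (p n : ℕ) (P : Fin n → Judg p) (ω : Judg p) : ℕ :=
  (Finset.univ.filter (fun j => P j = ω)).card

/-- The histogram, viewed as a vector in `ℝ^({0,1}^p)`. -/
def HistR (p n : ℕ) (P : Fin n → Judg p) : Judg p → ℝ :=
  fun ω => (Hist p n P ω : ℝ)

/-- `n_i(P)`: the number of agents of `P` whose judgement lies in `Ω_i`. -/
def nOnes (p n : ℕ) (f : Judg p → Bool) (P : Fin n → Judg p) (i : Fin (p + 1)) : ℕ :=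
  ∑ ω ∈ Omega p f i, Hist p n P ω

/-- The quota rule on profiles, with thresholds `q` and tie-breakings `d`. -/
def quota (p n : ℕ) (f : Judg p → Bool) (q : Fin (p + 1) → ℝ) (d : Fin (p + 1) → Bool)
    (P : Fin n → Judg p) (i : Fin (p + 1)) : Bool := by
  classical
  exact if (nOnes p n f P i : ℝ) > q i * (n : ℝ) then true
    else if (nOnes p n f P i : ℝ) = q i * (n : ℝ) then d i
    else false

/-- The real value of a bit: `1` for `1`/true, `0` for `0`/false. -/
def bval (b : Bool) : ℝ := if b then 1 else 0

/-- `sign(1) = 1` and `sign(0) = -1`. -/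
def sgn (b : Bool) : ℝ := if b then 1 else -1

/-- `α ∈ {0,1}^{p+1}` is consistent if its conclusion component equals `f` applied to
its premise components. -/
def Consistent (p : ℕ) (f : Judg p → Bool) (α : Fin (p + 1) → Bool) : Prop :=
  α (Fin.last p) = f (fun j => α j.castSucc)

/-- A profile is a doctrinal paradox if the quota-rule output is inconsistent. -/
def Paradox (p n : ℕ) (f : Judg p → Bool) (q : Fin (p + 1) → ℝ) (d : Fin (p + 1) → Bool)
    (P : Fin n → Judg p) : Prop :=
  ¬ Consistent p f (quota p n f q d P)

/-- The polyhedron `H_α`. -/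
def polyH (p : ℕ) (f : Judg p → Bool) (q : Fin (p + 1) → ℝ) (d : Fin (p + 1) → Bool)
    (α : Fin (p + 1) → Bool) : Set (Judg p → ℝ) :=
  {x | ∀ i : Fin (p + 1),
    sgn (α i) * inn p (cvec p f q i) x ≤ sgn (α i) * bval (d i) - bval (α i)}

/-- The characteristic cone `H_{α,≤0}`. -/
def coneH (p : ℕ) (f : Judg p → Bool) (q : Fin (p + 1) → ℝ)
    (α : Fin (p + 1) → Bool) : Set (Judg p → ℝ) :=
  {x | ∀ i : Fin (p + 1), sgn (α i) * inn p (cvec p f q i) x ≤ 0}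

/-- A probability distribution on `{0,1}^p`. -/
def IsDistribution (p : ℕ) (π : Judg p → ℝ) : Prop :=
  (∀ ω, 0 ≤ π ω) ∧ ∑ ω : Judg p, π ω = 1

/-- `pr_i(π) = Σ_{ω ∈ Ω_i} π(ω)`. -/
def pr (p : ℕ) (f : Judg p → Bool) (π : Judg p → ℝ) (i : Fin (p + 1)) : ℝ :=
  ∑ ω ∈ Omega p f i, π ω

/-- The quota rule applied to a distribution. -/
def quotaDist (p : ℕ) (f : Judg p → Bool) (q : Fin (p + 1) → ℝ) (d : Fin (p + 1) → Bool)
    (π : Judg p → ℝ) (i : Fin (p + 1)) : Bool := by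
  classical
  exact if pr p f π i > q i then true
    else if pr p f π i = q i then d i
    else false

/-- `α` is a refinement of `π`: it matches `r(π)` on every non-tied proposition. -/
def Refines (p : ℕ) (f : Judg p → Bool) (q : Fin (p + 1) → ℝ) (d : Fin (p + 1) → Bool)
    (π : Judg p → ℝ) (α : Fin (p + 1) → Bool) : Prop :=
  ∀ i : Fin (p + 1), pr p f π i ≠ q i → α i = quotaDist p f q d π i

/-- `α` is an effective refinement of `π` at `n`: a refinement realized by some profile. -/
def EffRef (p n : ℕ) (f : Judg p → Bool) (q : Fin (p + 1) → ℝ) (d : Fin (p + 1) → Bool)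
    (π : Judg p → ℝ) (α : Fin (p + 1) → Bool) : Prop :=
  Refines p f q d π α ∧ ∃ P : Fin n → Judg p, quota p n f q d P = α

/-- The probability that a random profile drawn from the independent (non-identical)
product of `vπ` is a doctrinal paradox. -/
def probParadox (p n : ℕ) (f : Judg p → Bool) (q : Fin (p + 1) → ℝ)
    (d : Fin (p + 1) → Bool) (vπ : Fin n → Judg p → ℝ) : ℝ := by
  classical
  exact ∑ P : Fin n → Judg p,
    if Paradox p n f q d P then ∏ j : Fin n, vπ j (P j) else 0

/-- The max-smoothed likelihood of the doctrinal paradox. -/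
def DPmax (p n : ℕ) (f : Judg p → Bool) (q : Fin (p + 1) → ℝ) (d : Fin (p + 1) → Bool)
    (D : Set (Judg p → ℝ)) : ℝ :=
  sSup {x : ℝ | ∃ vπ : Fin n → Judg p → ℝ,
    (∀ j, vπ j ∈ D) ∧ x = probParadox p n f q d vπ}

/-- The min-smoothed likelihood of the doctrinal paradox. -/
def DPmin (p n : ℕ) (f : Judg p → Bool) (q : Fin (p + 1) → ℝ) (d : Fin (p + 1) → Bool)
    (D : Set (Judg p → ℝ)) : ℝ :=
  sInf {x : ℝ | ∃ vπ : Fin n → Judg p → ℝ,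
    (∀ j, vπ j ∈ D) ∧ x = probParadox p n f q d vπ}

/-- Condition `κ1(n)`: no profile of `n` agents is a doctrinal paradox. -/
def kappa1 (p n : ℕ) (f : Judg p → Bool) (q : Fin (p + 1) → ℝ)
    (d : Fin (p + 1) → Bool) : Prop :=
  ∀ P : Fin n → Judg p, ¬ Paradox p n f q d P

/-- Condition `κ2(n)`: every effective refinement at `n` of every `π` in the convex hull
of `D` is consistent. -/
def kappa2 (p n : ℕ) (f : Judg p → Bool) (q : Fin (p + 1) → ℝ) (d : Fin (p + 1) → Bool)
    (D : Set (Judg p → ℝ)) : Prop :=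
  ∀ π ∈ convexHull ℝ D, ∀ α : Fin (p + 1) → Bool,
    EffRef p n f q d π α → Consistent p f α

/-- Condition `κ3(n)`: some `π` in the convex hull of `D` has all its effective
refinements at `n` consistent. -/
def kappa3 (p n : ℕ) (f : Judg p → Bool) (q : Fin (p + 1) → ℝ) (d : Fin (p + 1) → Bool)
    (D : Set (Judg p → ℝ)) : Prop :=
  ∃ π ∈ convexHull ℝ D, ∀ α : Fin (p + 1) → Bool,
    EffRef p n f q d π α → Consistent p f α

/-- Condition `κ4`: the conclusion depends on exactly one premise, with matching
thresholds. -/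
def kappa4 (p : ℕ) (f : Judg p → Bool) (q : Fin (p + 1) → ℝ) : Prop :=
  ∃ i : Fin p,
    ((∀ ω : Judg p, f ω = ω i) ∧ q (Fin.last p) = q i.castSucc) ∨
    ((∀ ω : Judg p, f ω = !(ω i)) ∧ q (Fin.last p) = 1 - q i.castSucc)

/-- `D` is strictly positive: some `ε > 0` lower-bounds every probability. -/
def StrictlyPositive (p : ℕ) (D : Set (Judg p → ℝ)) : Prop :=
  ∃ ε > (0 : ℝ), ∀ π ∈ D, ∀ ω : Judg p, ε ≤ π ω

section ProductWeights

variable {ι Ω : Type*} [Fintype ι] [Fintype Ω]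

lemma sum_pi_prod [DecidableEq ι] (μ : ι → Ω → ℝ) :
    ∑ P : ι → Ω, ∏ j, μ j (P j) = ∏ j, ∑ ω, μ j ω := by
  rw [Finset.prod_univ_sum, Fintype.piFinset_univ]

/-- A Chernoff bound for sums of bounded observables under a product of finite distributions. -/
lemma sum_prod_filter_sum_nonpos_le [DecidableEq ι] (μ : ι → Ω → ℝ) (hμ : ∀ j ω, 0 ≤ μ j ω)
    (hμ1 : ∀ j, ∑ ω, μ j ω = 1) (h : Ω → ℝ) (hh : ∀ ω, |h ω| ≤ 1) (t : ℝ) (ht : 0 ≤ t)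
    (ht1 : t ≤ 1) :
    ∑ P : ι → Ω with ∑ j, h (P j) ≤ 0, ∏ j, μ j (P j) ≤
      Real.exp (-t * ∑ j, ∑ ω, μ j ω * h ω + Fintype.card ι * t ^ 2) := by
  have hfac : ∀ j, ∑ ω, μ j ω * Real.exp (-t * h ω) ≤
      Real.exp (-t * ∑ ω, μ j ω * h ω + t ^ 2) := by
    intro j
    have hpt : ∀ ω, Real.exp (-t * h ω) ≤ 1 + -t * h ω + t ^ 2 := by
      intro ω
      have habs : |-t * h ω| ≤ t := by
        rw [abs_mul, abs_neg, abs_of_nonneg ht]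
        exact mul_le_of_le_one_right ht (hh ω)
      have h1 := (abs_le.1 (Real.abs_exp_sub_one_sub_id_le (habs.trans ht1))).2
      have h2 : (-t * h ω) ^ 2 ≤ t ^ 2 := sq_le_sq' (by linarith [(abs_le.1 habs).1])
        (abs_le.1 habs).2
      linarith
    calc ∑ ω, μ j ω * Real.exp (-t * h ω)
        ≤ ∑ ω, μ j ω * (1 + -t * h ω + t ^ 2) :=
          Finset.sum_le_sum fun ω _ => mul_le_mul_of_nonneg_left (hpt ω) (hμ j ω)
      _ = (-t * ∑ ω, μ j ω * h ω + t ^ 2) + 1 := by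
          have : ∀ ω, μ j ω * (1 + -t * h ω + t ^ 2) =
              (1 + t ^ 2) * μ j ω + -t * (μ j ω * h ω) := fun ω => by ring
          simp only [this, Finset.sum_add_distrib, ← Finset.mul_sum, hμ1]
          ring
      _ ≤ _ := Real.add_one_le_exp _
  calc ∑ P : ι → Ω with ∑ j, h (P j) ≤ 0, ∏ j, μ j (P j)
      ≤ ∑ P : ι → Ω with ∑ j, h (P j) ≤ 0, ∏ j, μ j (P j) * Real.exp (-t * h (P j)) := by
        refine Finset.sum_le_sum fun P hP => ?_
        rw [Finset.prod_mul_distrib, ← Real.exp_sum, ← Finset.mul_sum]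
        refine le_mul_of_one_le_right (Finset.prod_nonneg fun j _ => hμ j _) ?_
        rw [Real.one_le_exp_iff]
        exact mul_nonneg_of_nonpos_of_nonpos (by linarith) (Finset.mem_filter.1 hP).2
    _ ≤ ∑ P : ι → Ω, ∏ j, μ j (P j) * Real.exp (-t * h (P j)) :=
        Finset.sum_le_sum_of_subset_of_nonneg (Finset.filter_subset _ _) fun P _ _ =>
          Finset.prod_nonneg fun j _ => mul_nonneg (hμ j _) (Real.exp_pos _).le
    _ = ∏ j, ∑ ω, μ j ω * Real.exp (-t * h ω) :=
        sum_pi_prod fun j ω => μ j ω * Real.exp (-t * h ω)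
    _ ≤ ∏ j, Real.exp (-t * ∑ ω, μ j ω * h ω + t ^ 2) :=
        Finset.prod_le_prod (fun j _ => Finset.sum_nonneg fun ω _ =>
          mul_nonneg (hμ j _) (Real.exp_pos _).le) fun j _ => hfac j
    _ = _ := by
        rw [← Real.exp_sum, Finset.sum_add_distrib, ← Finset.mul_sum]
        simp

/-- Shifting every factor of a product distribution by the same vector `u` changes the
probability of an event in a controlled way. -/
lemma sq_sum_prod_add_le [DecidableEq ι] (μ : ι → Ω → ℝ) {ε : ℝ} (hε : 0 < ε)
    (hμ : ∀ j ω, ε ≤ μ j ω) (hμ1 : ∀ j, ∑ ω, μ j ω = 1) (u : Ω → ℝ) (hu : ∑ ω, u ω = 0)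
    (E : Finset (ι → Ω)) :
    (∑ P ∈ E, ∏ j, (μ j (P j) + u (P j))) ^ 2 ≤
      (∑ P ∈ E, ∏ j, μ j (P j)) *
        Real.exp (Fintype.card ι * ((∑ ω, u ω ^ 2) / ε)) := by
  have hpos : ∀ j ω, 0 < μ j ω := fun j ω => hε.trans_le (hμ j ω)
  have hfac : ∀ j, ∑ ω, (μ j ω + u ω) ^ 2 / μ j ω ≤ Real.exp ((∑ ω, u ω ^ 2) / ε) := by
    intro j
    calc ∑ ω, (μ j ω + u ω) ^ 2 / μ j ω
        ≤ ∑ ω, (μ j ω + 2 * u ω + u ω ^ 2 / ε) := by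
          refine Finset.sum_le_sum fun ω _ => ?_
          have h1 : (μ j ω + u ω) ^ 2 / μ j ω = μ j ω + 2 * u ω + u ω ^ 2 / μ j ω := by
            have := (hpos j ω).ne'
            field_simp
            ring
          rw [h1]
          gcongr
          exact hμ j ω
      _ = (∑ ω, u ω ^ 2) / ε + 1 := by
          rw [Finset.sum_add_distrib, Finset.sum_add_distrib, ← Finset.mul_sum, hμ1, hu,
            Finset.sum_div]
          ring
      _ ≤ _ := Real.add_one_le_exp _
  have hnn : ∀ P : ι → Ω, 0 ≤ ∏ j, (μ j (P j) + u (P j)) ^ 2 / μ j (P j) := fun P =>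
    Finset.prod_nonneg fun j _ => div_nonneg (sq_nonneg _) (hpos j _).le
  have hnn' : ∀ P : ι → Ω, 0 ≤ ∏ j, μ j (P j) := fun P =>
    Finset.prod_nonneg fun j _ => (hpos j _).le
  refine (Finset.sum_sq_le_sum_mul_sum_of_sq_le_mul E (fun P _ => hnn' P) (fun P _ => hnn P)
    fun P _ => le_of_eq ?_).trans (mul_le_mul_of_nonneg_left ?_ (Finset.sum_nonneg fun P _ => hnn' P))
  · rw [← Finset.prod_mul_distrib, ← Finset.prod_pow]
    refine Finset.prod_congr rfl fun j _ => ?_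
    rw [mul_div_cancel₀ _ (hpos j _).ne']
  · calc ∑ P ∈ E, ∏ j, (μ j (P j) + u (P j)) ^ 2 / μ j (P j)
        ≤ ∑ P : ι → Ω, ∏ j, (μ j (P j) + u (P j)) ^ 2 / μ j (P j) :=
          Finset.sum_le_sum_of_subset_of_nonneg (Finset.subset_univ _) fun P _ _ => hnn P
      _ = ∏ j, ∑ ω, (μ j ω + u ω) ^ 2 / μ j ω :=
          sum_pi_prod fun j ω => (μ j ω + u ω) ^ 2 / μ j ω
      _ ≤ ∏ _j : ι, Real.exp ((∑ ω, u ω ^ 2) / ε) :=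
          Finset.prod_le_prod (fun j _ => Finset.sum_nonneg fun ω _ =>
            div_nonneg (sq_nonneg _) (hpos j ω).le) fun j _ => hfac j
      _ = _ := by
          rw [Finset.prod_const, ← Real.exp_nat_mul, Finset.card_univ]

/-- If finitely many bounded observables have means of order the square root of the number of
factors, then they are simultaneously positive with probability at least `1 / 2`. -/
lemma half_le_sum_prod [DecidableEq ι] [Nonempty ι] {κ : Type*} [Fintype κ] (μ : ι → Ω → ℝ)
    (hμ : ∀ j ω, 0 ≤ μ j ω) (hμ1 : ∀ j, ∑ ω, μ j ω = 1) (I : Finset κ) (h : κ → Ω → ℝ)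
    (hh : ∀ i ω, |h i ω| ≤ 1)
    (hmean : ∀ i ∈ I, (Fintype.card κ + 2 : ℝ) * √(Fintype.card ι) ≤ ∑ j, ∑ ω, μ j ω * h i ω)
    (E : Finset (ι → Ω)) (hE : ∀ P : ι → Ω, (∀ i ∈ I, 0 < ∑ j, h i (P j)) → P ∈ E) :
    1 / 2 ≤ ∑ P ∈ E, ∏ j, μ j (P j) := by
  classical
  have hw : ∀ P : ι → Ω, 0 ≤ ∏ j, μ j (P j) := fun P => Finset.prod_nonneg fun j _ => hμ j _
  have hn : (1 : ℝ) ≤ Fintype.card ι := by exact_mod_cast Fintype.card_pos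
  have hs1 : 1 ≤ √(Fintype.card ι : ℝ) := Real.one_le_sqrt.2 hn
  have hs : √(Fintype.card ι : ℝ) ^ 2 = Fintype.card ι := Real.sq_sqrt (by positivity)
  set s : ℝ := √(Fintype.card ι : ℝ)
  have hs0 : 0 < s := by linarith
  set k : ℝ := (Fintype.card κ : ℝ)
  have hk : 0 ≤ k := Nat.cast_nonneg _
  have htail : ∀ i ∈ I, ∑ P : ι → Ω with ∑ j, h i (P j) ≤ 0, ∏ j, μ j (P j) ≤
      Real.exp (-(k + 1)) := by
    intro i hi
    refine (sum_prod_filter_sum_nonpos_le μ hμ hμ1 (h i) (hh i) s⁻¹ (by positivity)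
      (inv_le_one_of_one_le₀ hs1)).trans (Real.exp_le_exp.2 ?_)
    have h1 : s⁻¹ * ((k + 2) * s) ≤ s⁻¹ * ∑ j, ∑ ω, μ j ω * h i ω :=
      mul_le_mul_of_nonneg_left (hmean i hi) (by positivity)
    have h2 : s⁻¹ * ((k + 2) * s) = k + 2 := by field_simp
    have h3 : (Fintype.card ι : ℝ) * s⁻¹ ^ 2 = 1 := by rw [← hs]; field_simp
    rw [h3]
    linarith
  have hcover : ∀ P : ι → Ω, ∏ j, μ j (P j) ≤ (if P ∈ E then ∏ j, μ j (P j) else 0) +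
      ∑ i ∈ I, if ∑ j, h i (P j) ≤ 0 then ∏ j, μ j (P j) else 0 := by
    intro P
    have hnn : ∀ i ∈ I, 0 ≤ if ∑ j, h i (P j) ≤ 0 then ∏ j, μ j (P j) else 0 := by
      intro i _
      split_ifs
      exacts [hw P, le_rfl]
    by_cases hP : P ∈ E
    · rw [if_pos hP]
      exact le_add_of_nonneg_right (Finset.sum_nonneg hnn)
    · have hP' := mt (hE P) hP
      push Not at hP'
      obtain ⟨i, hi, hi'⟩ := hP'
      have := Finset.single_le_sum hnn hi
      rw [if_pos hi'] at this
      rw [if_neg hP, zero_add]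
      exact this
  have htot : (1 : ℝ) ≤ ∑ P ∈ E, ∏ j, μ j (P j) + k * Real.exp (-(k + 1)) := by
    calc (1 : ℝ) = ∑ P : ι → Ω, ∏ j, μ j (P j) := by rw [sum_pi_prod]; simp [hμ1]
      _ ≤ ∑ P ∈ E, ∏ j, μ j (P j) +
          ∑ i ∈ I, ∑ P : ι → Ω with ∑ j, h i (P j) ≤ 0, ∏ j, μ j (P j) := by
        refine (Finset.sum_le_sum fun P _ => hcover P).trans_eq ?_
        rw [Finset.sum_add_distrib, Finset.sum_comm]
        congr 1
        · rw [← Finset.sum_filter, Finset.filter_univ_mem]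
        · exact Finset.sum_congr rfl fun i _ => (Finset.sum_filter _ _).symm
      _ ≤ _ := by
        gcongr
        refine (Finset.sum_le_card_nsmul I _ _ htail).trans ?_
        rw [nsmul_eq_mul]
        gcongr
        exact Nat.cast_le.2 (Finset.card_le_univ I)
  have hexp : k * Real.exp (-(k + 1)) ≤ 1 / 2 := by
    rw [Real.exp_neg, ← div_eq_mul_inv, div_le_iff₀ (Real.exp_pos _), Real.exp_add]
    have h1 := Real.add_one_le_exp k
    have h2 := Real.add_one_le_exp 1
    nlinarith
  linarith

end ProductWeights

/-- Multiples of a point of the convex hull are sums of points of the set, up to a bounded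
error. -/
lemma exists_sum_near_nsmul_of_mem_convexHull {E : Type*} [NormedAddCommGroup E]
    [NormedSpace ℝ E] {D : Set E} {x : E} (hx : x ∈ convexHull ℝ D) :
    ∃ C : ℝ, ∀ n : ℕ, ∃ v : Fin n → E, (∀ j, v j ∈ D) ∧ ‖∑ j, v j - (n : ℝ) • x‖ ≤ C := by
  refine convexHull_min (s := D) (t := {x : E | ∃ C : ℝ, ∀ n : ℕ, ∃ v : Fin n → E,
    (∀ j, v j ∈ D) ∧ ‖∑ j, v j - (n : ℝ) • x‖ ≤ C}) ?_ ?_ hx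
  · intro y hy
    exact ⟨0, fun n => ⟨fun _ => y, fun _ => hy, by simp [← Nat.cast_smul_eq_nsmul ℝ]⟩⟩
  · rintro y ⟨C₁, h₁⟩ z ⟨C₂, h₂⟩ a b ha hb hab
    refine ⟨C₁ + C₂ + (‖y‖ + ‖z‖), fun n => ?_⟩
    have han : 0 ≤ a * n := by positivity
    have hle : ⌊a * n⌋₊ ≤ n := by
      refine Nat.floor_le_of_le ?_
      exact mul_le_of_le_one_left (by positivity) (by linarith)
    have hf1 := Nat.floor_le han
    have hf2 := Nat.lt_floor_add_one (a * n)
    obtain ⟨k, hk⟩ := Nat.exists_eq_add_of_le hle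
    generalize ⌊a * n⌋₊ = m at *
    subst hk
    obtain ⟨v, hv, hv'⟩ := h₁ m
    obtain ⟨w, hw, hw'⟩ := h₂ k
    refine ⟨Fin.append v w, fun j => ?_, ?_⟩
    · refine Fin.addCases (fun i => ?_) (fun i => ?_) j
      · simpa using hv i
      · simpa using hw i
    · rw [Fin.sum_univ_add]
      simp only [Fin.append_left, Fin.append_right]
      set r : ℝ := a * ((m + k : ℕ) : ℝ) - m with hr
      have hr1 : |r| ≤ 1 := abs_le.2 ⟨by linarith, by linarith⟩
      have key : ∑ i, v i + ∑ i, w i - ((m + k : ℕ) : ℝ) • (a • y + b • z) =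
          (∑ i, v i - (m : ℝ) • y) + (∑ i, w i - (k : ℝ) • z) + (r • z - r • y) := by
        obtain rfl : b = 1 - a := by linarith
        rw [hr]
        push_cast
        module
      rw [key]
      refine (norm_add_le _ _).trans (add_le_add ((norm_add_le _ _).trans
        (add_le_add hv' hw')) ((norm_sub_le _ _).trans ?_))
      rw [norm_smul, norm_smul, Real.norm_eq_abs, add_comm]
      exact add_le_add (mul_le_of_le_one_left (norm_nonneg _) hr1)
        (mul_le_of_le_one_left (norm_nonneg _) hr1)

lemma bval_injective : Function.Injective bval := by
  intro a b
  cases a <;> cases b <;> simp [bval]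

/-- A Boolean function that is affine over the reals is constant, a coordinate, or a negated
coordinate. -/
lemma eq_const_or_dictator_of_affine {p : ℕ} (f : Judg p → Bool) (a : ℝ) (c : Fin p → ℝ)
    (h : ∀ ω, bval (f ω) = a + ∑ i, c i * bval (ω i)) :
    (∀ ω ω', f ω = f ω') ∨
      ∃ i, c i ≠ 0 ∧ ((∀ ω, f ω = ω i) ∨ ∀ ω, f ω = !(ω i)) := by
  classical
  by_cases hc : ∀ i, c i = 0
  · left
    intro ω ω'
    apply bval_injective
    simp [h, hc]
  push Not at hc
  obtain ⟨i, hi⟩ := hc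
  have hbv : ∀ b : Bool, bval b = 0 ∨ bval b = 1 := fun b => by cases b <;> simp [bval]
  have h0 : bval (f fun _ => false) = a := by rw [h]; simp [bval]
  have h1 : ∀ j, bval (f fun k => decide (k = j)) = a + c j := by
    intro j; rw [h]; simp [bval]
  have h2 : ∀ j, j ≠ i → c j = 0 := by
    intro j hj
    have h3 : bval (f fun k => decide (k = j ∨ k = i)) = a + (c j + c i) := by
      rw [h]
      congr 1
      have : ∀ k, c k * bval (decide (k = j ∨ k = i)) =
          (if k = j then c k else 0) + if k = i then c k else 0 := by
        intro k
        by_cases hkj : k = j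
        · subst hkj; simp [bval, hj]
        · simp [bval, hkj]
      simp only [this, Finset.sum_add_distrib]
      simp
    have e0 := hbv (f fun _ => false)
    have e1 := hbv (f fun k => decide (k = j))
    have e2 := hbv (f fun k => decide (k = i))
    have e3 := hbv (f fun k => decide (k = j ∨ k = i))
    rw [h0] at e0
    rw [h1] at e1 e2
    rw [h3] at e3
    by_contra hcj
    grind
  have h4 : ∀ ω, bval (f ω) = a + c i * bval (ω i) := by
    intro ω
    rw [h, Finset.sum_eq_single i (fun j _ hj => by simp [h2 j hj]) (by simp)]
  have e0 := hbv (f fun _ => false)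
  have e2 := hbv (f fun k => decide (k = i))
  rw [h0] at e0
  rw [h1] at e2
  right
  refine ⟨i, hi, ?_⟩
  rcases e0 with e0 | e0
  · left
    intro ω
    apply bval_injective
    have : c i = 1 := by grind
    rw [h4, e0, this]
    simp
  · right
    intro ω
    apply bval_injective
    have : c i = -1 := by grind
    rw [h4, e0, this]
    cases ω i <;> simp [bval]

lemma pr_castSucc (p : ℕ) (f : Judg p → Bool) (v : Judg p → ℝ) (i : Fin p) :
    pr p f v i.castSucc = ∑ ω, v ω * bval (ω i) := by
  simp [pr, Omega, Finset.sum_filter, bval]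

lemma pr_last (p : ℕ) (f : Judg p → Bool) (v : Judg p → ℝ) :
    pr p f v (Fin.last p) = ∑ ω, v ω * bval (f ω) := by
  simp [pr, Omega, Finset.sum_filter, bval]

/-- The functional `v ↦ Σ_ω v(ω) g(ω)`. -/
def pairing {Ω : Type*} [Fintype Ω] (g : Ω → ℝ) : (Ω → ℝ) →ₗ[ℝ] ℝ :=
  ∑ ω, g ω • LinearMap.proj ω

lemma pairing_apply {Ω : Type*} [Fintype Ω] (g v : Ω → ℝ) :
    pairing g v = ∑ ω, v ω * g ω := by
  simp [pairing, mul_comm]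

lemma pairing_single {Ω : Type*} [Fintype Ω] [DecidableEq Ω] (g : Ω → ℝ) (ω : Ω) :
    pairing g (Pi.single ω 1) = g ω := by
  simp [pairing_apply, Pi.single_apply]

lemma exists_sum_eq_zero_pr_castSucc_eq (p : ℕ) (f : Judg p → Bool) (s : Fin p → ℝ) :
    ∃ v : Judg p → ℝ, ∑ ω, v ω = 0 ∧ ∀ i : Fin p, pr p f v i.castSucc = s i := by
  classical
  let e : Fin p → Judg p := fun i k => decide (k = i)
  let v : Judg p → ℝ :=
    ∑ i, s i • (Pi.single (e i) 1 - Pi.single (fun _ => false) 1)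
  have key : ∀ g : Judg p → ℝ, ∑ ω, v ω * g ω = ∑ i, s i * (g (e i) - g fun _ => false) := by
    intro g
    rw [← pairing_apply, map_sum]
    simp only [map_smul, map_sub, pairing_single, smul_eq_mul]
  refine ⟨v, ?_, fun i => ?_⟩
  · simpa using key fun _ => 1
  · rw [pr_castSucc, key fun ω => bval (ω i)]
    simp [e, bval]

/-- In the absence of `kappa4`, the tied propositions can be perturbed independently of each
other. -/
lemma exists_direction (p : ℕ) (f : Judg p → Bool) (q : Fin (p + 1) → ℝ)
    (hk4 : ¬ kappa4 p f q) (π : Judg p → ℝ) (hπ : ∑ ω, π ω = 1) (s : Fin (p + 1) → ℝ) :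
    ∃ v : Judg p → ℝ, ∑ ω, v ω = 0 ∧ ∀ i, pr p f π i = q i →
      (i = Fin.last p → ∃ ω ω', f ω ≠ f ω') → pr p f v i = s i := by
  classical
  obtain ⟨v, hv0, hv⟩ := exists_sum_eq_zero_pr_castSucc_eq p f fun i => s i.castSucc
  by_cases hl : pr p f π (Fin.last p) = q (Fin.last p) ∧ ∃ ω ω', f ω ≠ f ω'
  swap
  · refine ⟨v, hv0, fun i => Fin.lastCases (fun h1 h2 => ?_) (fun i _ _ => hv i) i⟩
    exact absurd ⟨h1, h2 rfl⟩ hl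
  obtain ⟨hlast, hf⟩ := hl
  let g : Option (Fin p) → Judg p → ℝ := fun o ω => o.elim 1 fun i =>
    if pr p f π i.castSucc = q i.castSucc then bval (ω i) else 0
  have hker : ¬ (⨅ o, LinearMap.ker (pairing (g o)) ≤
      LinearMap.ker (pairing fun ω => bval (f ω))) := by
    intro hle
    have hmem := mem_span_of_iInf_ker_le_ker hle
    rw [Submodule.mem_span_range_iff_exists_fun] at hmem
    obtain ⟨c, hc⟩ := hmem
    have haff : ∀ ω, bval (f ω) = c none +
        ∑ i, (if pr p f π i.castSucc = q i.castSucc then c (some i) else 0) * bval (ω i) := by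
      intro ω
      have := LinearMap.congr_fun hc (Pi.single ω 1)
      rw [LinearMap.sum_apply, pairing_single] at this
      simp only [LinearMap.smul_apply, pairing_single, smul_eq_mul] at this
      rw [← this, Fintype.sum_option]
      simp [g]
    rcases eq_const_or_dictator_of_affine f _ _ haff with hconst | ⟨i, hi, hdict⟩
    · obtain ⟨ω, ω', h⟩ := hf
      exact h (hconst ω ω')
    have hti : pr p f π i.castSucc = q i.castSucc := by
      by_contra hne
      simp [hne] at hi
    refine hk4 ⟨i, ?_⟩
    rw [← hti, ← hlast, pr_castSucc, pr_last]
    rcases hdict with hd | hd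
    · left
      exact ⟨hd, by simp [hd]⟩
    · right
      refine ⟨hd, ?_⟩
      rw [← hπ, ← Finset.sum_sub_distrib]
      refine Finset.sum_congr rfl fun ω _ => ?_
      rw [hd]
      cases ω i <;> simp [bval]
  obtain ⟨u, hu, hu'⟩ := SetLike.not_le_iff_exists.1 hker
  simp only [Submodule.mem_iInf, LinearMap.mem_ker, pairing_apply] at hu hu'
  have hu0 : ∑ ω, u ω = 0 := by simpa [g] using hu none
  set b := (s (Fin.last p) - pr p f v (Fin.last p)) / ∑ ω, u ω * bval (f ω) with hb
  have hadd : ∀ w : Judg p → ℝ,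
      ∑ ω, (v + b • u) ω * w ω = ∑ ω, v ω * w ω + b * ∑ ω, u ω * w ω := by
    intro w
    rw [Finset.mul_sum, ← Finset.sum_add_distrib]
    exact Finset.sum_congr rfl fun ω _ => by simp; ring
  refine ⟨v + b • u, ?_, fun i => Fin.lastCases (fun _ _ => ?_) (fun i hi _ => ?_) i⟩
  · simpa [hv0, hu0] using hadd fun _ => 1
  · rw [pr_last, hadd, ← pr_last p f v, hb, div_mul_cancel₀ _ hu']
    ring
  · have h0 : ∑ ω, u ω * bval (ω i) = 0 := by simpa [g, hi] using hu (some i)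
    rw [pr_castSucc, hadd, ← pr_castSucc p f v, hv, h0]
    ring

lemma abs_sgn (b : Bool) : |sgn b| = 1 := by cases b <;> simp [sgn]

lemma sgn_mul_self (b : Bool) : sgn b * sgn b = 1 := by cases b <;> simp [sgn]

/-- The contribution of a judgement towards outcome `α i` in proposition `i`. -/
def margin (p : ℕ) (f : Judg p → Bool) (q : Fin (p + 1) → ℝ) (α : Fin (p + 1) → Bool)
    (i : Fin (p + 1)) (ω : Judg p) : ℝ :=
  sgn (α i) * -cvec p f q i ω

lemma abs_margin_le {p : ℕ} (f : Judg p → Bool) {q : Fin (p + 1) → ℝ}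
    (hq : ∀ i, q i ∈ Set.Icc (0 : ℝ) 1) (α : Fin (p + 1) → Bool) (i : Fin (p + 1))
    (ω : Judg p) : |margin p f q α i ω| ≤ 1 := by
  obtain ⟨h0, h1⟩ := hq i
  rw [margin, abs_mul, abs_sgn, one_mul, abs_neg, cvec, abs_le]
  split_ifs <;> constructor <;> linarith

lemma sum_mul_margin (p : ℕ) (f : Judg p → Bool) (q : Fin (p + 1) → ℝ)
    (α : Fin (p + 1) → Bool) (i : Fin (p + 1)) (v : Judg p → ℝ) :
    ∑ ω, v ω * margin p f q α i ω = sgn (α i) * (pr p f v i - q i * ∑ ω, v ω) := by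
  have h : ∀ ω, v ω * margin p f q α i ω =
      sgn (α i) * ((if ω ∈ Omega p f i then v ω else 0) - q i * v ω) := by
    intro ω
    rw [margin, cvec]
    split_ifs <;> ring
  simp only [h, ← Finset.mul_sum, Finset.sum_sub_distrib]
  congr 2
  rw [← Finset.sum_filter, Finset.filter_univ_mem, pr]

lemma nOnes_eq_card (p n : ℕ) (f : Judg p → Bool) (P : Fin n → Judg p) (i : Fin (p + 1)) :
    nOnes p n f P i = (Finset.univ.filter fun j => P j ∈ Omega p f i).card := by
  rw [nOnes, Finset.card_eq_sum_card_fiberwise (f := P) (t := Omega p f i)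
    (fun j hj => by simpa using hj)]
  refine Finset.sum_congr rfl fun ω hω => ?_
  rw [Hist, Finset.filter_filter]
  congr 1
  ext j
  simp only [Finset.mem_filter, Finset.mem_univ, true_and]
  exact ⟨fun h => ⟨h ▸ hω, h⟩, fun h => h.2⟩

lemma sum_margin (p n : ℕ) (f : Judg p → Bool) (q : Fin (p + 1) → ℝ)
    (α : Fin (p + 1) → Bool) (P : Fin n → Judg p) (i : Fin (p + 1)) :
    ∑ j, margin p f q α i (P j) = sgn (α i) * (nOnes p n f P i - q i * n) := by
  have h : ∀ j, margin p f q α i (P j) =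
      sgn (α i) * ((if P j ∈ Omega p f i then 1 else 0) - q i) := by
    intro j
    rw [margin, cvec]
    split_ifs <;> ring
  simp only [h, ← Finset.mul_sum, Finset.sum_sub_distrib]
  rw [nOnes_eq_card, Finset.sum_boole]
  simp [mul_comm]

lemma quota_eq_of_sum_margin_pos {p n : ℕ} {f : Judg p → Bool} {q : Fin (p + 1) → ℝ}
    (d : Fin (p + 1) → Bool) {α : Fin (p + 1) → Bool} {P : Fin n → Judg p} {i : Fin (p + 1)}
    (h : 0 < ∑ j, margin p f q α i (P j)) : quota p n f q d P i = α i := by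
  rw [sum_margin] at h
  cases hα : α i
  · rw [hα] at h
    have h' : (nOnes p n f P i : ℝ) < q i * n := by
      simp only [sgn, Bool.false_eq_true, if_false] at h
      linarith
    simp [quota, h'.not_gt, h'.ne]
  · rw [hα] at h
    have h' : q i * n < (nOnes p n f P i : ℝ) := by
      simp only [sgn, if_true] at h
      linarith
    simp [quota, h']

lemma Refines.pos_of_ne {p : ℕ} {f : Judg p → Bool} {q : Fin (p + 1) → ℝ}
    {d α : Fin (p + 1) → Bool} {π : Judg p → ℝ} (h : Refines p f q d π α) {i : Fin (p + 1)}
    (hi : pr p f π i ≠ q i) : 0 < sgn (α i) * (pr p f π i - q i) := by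
  rw [h i hi, quotaDist]
  rcases hi.lt_or_gt with h1 | h1
  · simp [h1.not_gt, h1.ne, sgn, h1]
  · simp [h1, sgn]

/-- A constant conclusion that is tied for some distribution is tied for every profile. -/
lemma quota_last_eq_of_const {p : ℕ} (n : ℕ) {f : Judg p → Bool} {q : Fin (p + 1) → ℝ}
    (d : Fin (p + 1) → Bool) {π : Judg p → ℝ} (hπ : ∑ ω, π ω = 1)
    (ht : pr p f π (Fin.last p) = q (Fin.last p)) (hf : ∀ ω ω', f ω = f ω')
    (P : Fin n → Judg p) : quota p n f q d P (Fin.last p) = d (Fin.last p) := by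
  have hpr : bval (f fun _ => false) = q (Fin.last p) := by
    rw [← ht, pr_last, ← one_mul (bval _), ← hπ, Finset.sum_mul]
    exact Finset.sum_congr rfl fun ω _ => by rw [hf ω fun _ => false]
  have hn : (nOnes p n f P (Fin.last p) : ℝ) = q (Fin.last p) * n := by
    rw [nOnes_eq_card, ← hpr]
    have : ∀ j, P j ∈ Omega p f (Fin.last p) ↔ f (fun _ => false) = true := by
      intro j
      rw [← hf (P j)]
      simp [Omega]
    simp only [this]
    cases f fun _ => false <;> simp [bval]
  simp [quota, hn]

lemma probParadox_le_one {p n : ℕ} (f : Judg p → Bool) (q : Fin (p + 1) → ℝ)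
    (d : Fin (p + 1) → Bool) {μ : Fin n → Judg p → ℝ} (hμ : ∀ j, IsDistribution p (μ j)) :
    probParadox p n f q d μ ≤ 1 := by
  classical
  calc probParadox p n f q d μ ≤ ∑ P : Fin n → Judg p, ∏ j, μ j (P j) := by
        rw [probParadox]
        refine Finset.sum_le_sum fun P _ => ?_
        split_ifs
        exacts [le_rfl, Finset.prod_nonneg fun j _ => (hμ j).1 _]
    _ = 1 := by
        rw [sum_pi_prod]
        simp [(hμ _).2]

lemma sum_prod_le_probParadox {p n : ℕ} {f : Judg p → Bool} {q : Fin (p + 1) → ℝ}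
    {d : Fin (p + 1) → Bool} {μ : Fin n → Judg p → ℝ} (hμ : ∀ j, IsDistribution p (μ j))
    (E : Finset (Fin n → Judg p)) (hE : ∀ P ∈ E, Paradox p n f q d P) :
    ∑ P ∈ E, ∏ j, μ j (P j) ≤ probParadox p n f q d μ := by
  classical
  rw [probParadox, ← Finset.sum_filter]
  exact Finset.sum_le_sum_of_subset_of_nonneg (fun P hP => by simpa using hE P hP)
    fun P _ _ => Finset.prod_nonneg fun j _ => (hμ j).1 _

lemma probParadox_le_DPmax {p n : ℕ} (f : Judg p → Bool) (q : Fin (p + 1) → ℝ)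
    (d : Fin (p + 1) → Bool) {D : Set (Judg p → ℝ)} (hD : ∀ π ∈ D, IsDistribution p π)
    {μ : Fin n → Judg p → ℝ} (hμ : ∀ j, μ j ∈ D) :
    probParadox p n f q d μ ≤ DPmax p n f q d D := by
  refine le_csSup ⟨1, ?_⟩ ⟨μ, hμ, rfl⟩
  rintro x ⟨ν, hν, rfl⟩
  exact probParadox_le_one f q d fun j => hD _ (hν j)

lemma sum_eq_one_of_mem_convexHull {p : ℕ} {D : Set (Judg p → ℝ)}
    (hD : ∀ π ∈ D, IsDistribution p π) {π : Judg p → ℝ} (hπ : π ∈ convexHull ℝ D) :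
    ∑ ω, π ω = 1 := by
  refine convexHull_min (t := {π : Judg p → ℝ | ∑ ω, π ω = 1}) (fun π hπ => (hD π hπ).2) ?_ hπ
  intro x hx y hy a b _ _ hab
  simp only [Set.mem_ofPred_eq] at hx hy ⊢
  simp [Finset.sum_add_distrib, ← Finset.mul_sum, hx, hy, hab]

/-- An outcome refining a point of the convex hull is reached with probability bounded below,
for every large number of agents for which it is reachable at all. -/
lemma exists_forall_le_sum_prod {p : ℕ} {f : Judg p → Bool} {q : Fin (p + 1) → ℝ}
    (hq : ∀ i, q i ∈ Set.Icc (0 : ℝ) 1) {d : Fin (p + 1) → Bool} {D : Set (Judg p → ℝ)}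
    (hsp : StrictlyPositive p D) (hdist : ∀ π ∈ D, IsDistribution p π)
    (hk4 : ¬ kappa4 p f q) {π : Judg p → ℝ} (hπ : π ∈ convexHull ℝ D)
    {α : Fin (p + 1) → Bool} (hα : Refines p f q d π α) :
    ∃ c > (0 : ℝ), ∃ N : ℕ, ∀ n ≥ N, (∃ P : Fin n → Judg p, quota p n f q d P = α) →
      ∃ μ : Fin n → Judg p → ℝ, (∀ j, μ j ∈ D) ∧
        c ≤ ∑ P : Fin n → Judg p with quota p n f q d P = α, ∏ j, μ j (P j) := by
  classical
  obtain ⟨ε, hε, hεD⟩ := hsp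
  have hπ1 := sum_eq_one_of_mem_convexHull hdist hπ
  obtain ⟨v, hv0, hv⟩ := exists_direction p f q hk4 π hπ1 fun i => sgn (α i)
  obtain ⟨C, hC⟩ := exists_sum_near_nsmul_of_mem_convexHull hπ
  have hC0 : 0 ≤ C := (norm_nonneg _).trans (hC 0).choose_spec.2
  let h := margin p f q α
  have hh : ∀ i ω, |h i ω| ≤ 1 := abs_margin_le f hq α
  let m : ℝ := Fintype.card (Judg p)
  let L : ℝ := Fintype.card (Fin (p + 1)) + 2
  let K : ℝ := L + C * m
  have hm : 0 ≤ m := Nat.cast_nonneg _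
  have hL : 0 ≤ L := by positivity
  have hK : 0 ≤ K := by positivity
  let I : Finset (Fin (p + 1)) := Finset.univ.filter fun i =>
    pr p f π i = q i → i = Fin.last p → ∃ ω ω', f ω ≠ f ω'
  have hvh : ∀ i ∈ I, pr p f π i = q i → ∑ ω, v ω * h i ω = 1 := by
    intro i hi ht
    rw [sum_mul_margin, hv0, hv i ht ((Finset.mem_filter.1 hi).2 ht), mul_zero, sub_zero,
      sgn_mul_self]
  have hsqrt : Filter.Tendsto (fun n : ℕ => √(n : ℝ)) Filter.atTop Filter.atTop :=
    Real.tendsto_sqrt_atTop.comp tendsto_natCast_atTop_atTop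
  have hev1 : ∀ᶠ n : ℕ in Filter.atTop, ∀ i, pr p f π i ≠ q i →
      C * m + |K * ∑ ω, v ω * h i ω| + L ≤ (∑ ω, π ω * h i ω) * √(n : ℝ) := by
    rw [Filter.eventually_all]
    intro i
    by_cases hi : pr p f π i = q i
    · simp [hi]
    have hpos : 0 < ∑ ω, π ω * h i ω := by
      rw [sum_mul_margin, hπ1, mul_one]
      exact hα.pos_of_ne hi
    filter_upwards [(hsqrt.const_mul_atTop hpos).eventually_ge_atTop _] with n hn _ using hn
  have hev2 : ∀ᶠ n : ℕ in Filter.atTop, K * ‖v‖ ≤ ε * √(n : ℝ) :=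
    (hsqrt.const_mul_atTop hε).eventually_ge_atTop _
  obtain ⟨N, hN⟩ := Filter.eventually_atTop.1
    ((hev1.and hev2).and (Filter.eventually_ge_atTop 1))
  refine ⟨1 / 4 * Real.exp (-(K ^ 2 * (∑ ω, v ω ^ 2) / ε)), by positivity, N,
    fun n hn hreach => ?_⟩
  obtain ⟨⟨hn1, hn2⟩, hn3⟩ := hN n hn
  obtain ⟨μ, hμ, hμC⟩ := hC n
  obtain ⟨P₀, hP₀⟩ := hreach
  have : Nonempty (Fin n) := ⟨⟨0, hn3⟩⟩
  refine ⟨μ, hμ, ?_⟩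
  have hs1 : 1 ≤ √(n : ℝ) := Real.one_le_sqrt.2 (by exact_mod_cast hn3)
  have hs : √(n : ℝ) ^ 2 = n := Real.sq_sqrt (by positivity)
  set s : ℝ := √(n : ℝ) with hs_def
  have hs0 : 0 < s := by linarith
  let u : Judg p → ℝ := fun ω => K / s * v ω
  have hu0 : ∑ ω, u ω = 0 := by rw [← Finset.mul_sum, hv0, mul_zero]
  have hmean : ∀ i, n * (∑ ω, π ω * h i ω) - C * m + K * s * ∑ ω, v ω * h i ω ≤
      ∑ j, ∑ ω, (μ j ω + u ω) * h i ω := by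
    intro i
    set w := ∑ j, μ j - (n : ℝ) • π with hw
    have hwb : -(C * m) ≤ ∑ ω, w ω * h i ω := by
      refine (abs_le.1 ((Finset.abs_sum_le_sum_abs _ _).trans
        ((Finset.sum_le_card_nsmul _ _ C fun ω _ => ?_).trans_eq ?_))).1
      · rw [abs_mul]
        exact (mul_le_of_le_one_right (abs_nonneg _) (hh i ω)).trans
          ((norm_le_pi_norm w ω).trans hμC)
      · rw [nsmul_eq_mul, Finset.card_univ, mul_comm]
    have hexpand : ∑ j, ∑ ω, (μ j ω + u ω) * h i ω =
        n * (∑ ω, π ω * h i ω) + ∑ ω, w ω * h i ω + K * s * ∑ ω, v ω * h i ω := by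
      rw [Finset.sum_comm]
      simp only [Finset.mul_sum, ← Finset.sum_add_distrib, ← Finset.sum_mul]
      refine Finset.sum_congr rfl fun ω _ => ?_
      simp only [Finset.sum_add_distrib, Finset.sum_const, Finset.card_univ, Fintype.card_fin,
        nsmul_eq_mul, hw, Pi.sub_apply, Finset.sum_apply, Pi.smul_apply, smul_eq_mul, u]
      have : (n : ℝ) * (K / s * v ω) = K * s * v ω := by
        rw [← hs]
        field_simp
      rw [this]
      ring
    rw [hexpand]
    linarith
  have hlarge : ∀ i ∈ I, L * s ≤ ∑ j, ∑ ω, (μ j ω + u ω) * h i ω := by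
    intro i hi
    refine le_trans ?_ (hmean i)
    have hCm : 0 ≤ C * m := by positivity
    by_cases ht : pr p f π i = q i
    · have hz : ∑ ω, π ω * h i ω = 0 := by
        rw [sum_mul_margin, hπ1, ht]
        ring
      rw [hz, hvh i hi ht]
      have : C * m ≤ C * m * s := le_mul_of_one_le_right hCm hs1
      simp only [K]
      linarith
    · have h1 := mul_le_mul_of_nonneg_right (hn1 i ht) hs0.le
      have h2 : -|K * ∑ ω, v ω * h i ω| * s ≤ (K * ∑ ω, v ω * h i ω) * s :=
        mul_le_mul_of_nonneg_right (neg_abs_le _) hs0.le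
      have h3 : C * m ≤ C * m * s := le_mul_of_one_le_right hCm hs1
      have h4 : (∑ ω, π ω * h i ω) * s * s = n * ∑ ω, π ω * h i ω := by
        rw [← hs]
        ring
      linarith
  have hu : ∀ ω, |u ω| ≤ ε := by
    intro ω
    have h1 : |v ω| ≤ ‖v‖ := norm_le_pi_norm v ω
    rw [abs_mul, abs_of_nonneg (by positivity), div_mul_eq_mul_div, div_le_iff₀ hs0]
    exact (mul_le_mul_of_nonneg_left h1 hK).trans hn2
  have hhalf := half_le_sum_prod (fun j ω => μ j ω + u ω)
    (fun j ω => by linarith [hεD _ (hμ j) ω, (abs_le.1 (hu ω)).1])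
    (fun j => by rw [Finset.sum_add_distrib, hu0, (hdist _ (hμ j)).2, add_zero]) I h hh
    (by simpa only [Fintype.card_fin n] using hlarge)
    (Finset.univ.filter fun P => quota p n f q d P = α) (by
      intro P hP
      rw [Finset.mem_filter]
      refine ⟨Finset.mem_univ _, funext fun i => ?_⟩
      by_cases hi : i ∈ I
      · exact quota_eq_of_sum_margin_pos d (hP i hi)
      · simp only [I, Finset.mem_filter, Finset.mem_univ, true_and] at hi
        push Not at hi
        obtain ⟨ht, rfl, hf⟩ := hi
        rw [← hP₀, quota_last_eq_of_const n d hπ1 ht hf, quota_last_eq_of_const n d hπ1 ht hf])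
  have hsq := sq_sum_prod_add_le μ hε (fun j => hεD _ (hμ j)) (fun j => (hdist _ (hμ j)).2) u
    hu0 (Finset.univ.filter fun P => quota p n f q d P = α)
  have hexp : (Fintype.card (Fin n) : ℝ) * ((∑ ω, u ω ^ 2) / ε) =
      K ^ 2 * (∑ ω, v ω ^ 2) / ε := by
    simp only [u, mul_pow, ← Finset.mul_sum, Fintype.card_fin]
    rw [← hs]
    field_simp
  rw [hexp] at hsq
  rw [Real.exp_neg, ← div_eq_mul_inv, div_le_iff₀ (Real.exp_pos _)]
  refine le_trans ?_ hsq
  nlinarith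

/-- An inconsistent outcome forces a uniform lower bound on `DPmax` whenever it is an effective
refinement of a point of the convex hull. -/
lemma exists_le_DPmax_of_not_consistent {p : ℕ} {f : Judg p → Bool} {q : Fin (p + 1) → ℝ}
    (hq : ∀ i, q i ∈ Set.Icc (0 : ℝ) 1) {d : Fin (p + 1) → Bool} {D : Set (Judg p → ℝ)}
    (hne : D.Nonempty) (hsp : StrictlyPositive p D) (hdist : ∀ π ∈ D, IsDistribution p π)
    (hk4 : ¬ kappa4 p f q) {α : Fin (p + 1) → Bool} (hα : ¬ Consistent p f α) :
    ∃ c > (0 : ℝ), ∀ n : ℕ, (∃ π ∈ convexHull ℝ D, EffRef p n f q d π α) →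
      c ≤ DPmax p n f q d D := by
  classical
  by_cases hex : ∃ π ∈ convexHull ℝ D, Refines p f q d π α
  swap
  · exact ⟨1, one_pos, fun n ⟨π, hπ, hr, _⟩ => absurd ⟨π, hπ, hr⟩ hex⟩
  obtain ⟨π, hπ, hr⟩ := hex
  obtain ⟨c, hc, N, hN⟩ := exists_forall_le_sum_prod hq hsp hdist hk4 hπ hr
  obtain ⟨ε, hε, hεD⟩ := hsp
  obtain ⟨π₁, hπ₁⟩ := hne
  have hε1 : ε ≤ 1 := (hεD π₁ hπ₁ fun _ => false).trans <| (hdist π₁ hπ₁).2 ▸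
    Finset.single_le_sum (fun ω _ => (hdist π₁ hπ₁).1 ω) (Finset.mem_univ _)
  refine ⟨min c (ε ^ N), lt_min hc (by positivity), fun n ⟨_, _, _, hreach⟩ => ?_⟩
  by_cases hn : N ≤ n
  · obtain ⟨μ, hμ, hle⟩ := hN n hn hreach
    refine (min_le_left _ _).trans (hle.trans
      ((sum_prod_le_probParadox (fun j => hdist _ (hμ j)) _ fun P hP => ?_).trans
        (probParadox_le_DPmax f q d hdist hμ)))
    rw [Paradox, (Finset.mem_filter.1 hP).2]
    exact hα
  · obtain ⟨P, hP⟩ := hreach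
    refine (min_le_right _ _).trans (le_trans ?_
      ((sum_prod_le_probParadox (μ := fun _ => π₁) (fun _ => hdist _ hπ₁) {P} ?_).trans
        (probParadox_le_DPmax f q d hdist fun _ => hπ₁)))
    · rw [Finset.sum_singleton]
      calc ε ^ N ≤ ε ^ n := pow_le_pow_of_le_one hε.le hε1 (not_le.1 hn).le
        _ = ∏ _j : Fin n, ε := by simp
        _ ≤ _ := Finset.prod_le_prod (fun _ _ => hε.le) fun j _ => hεD π₁ hπ₁ _
    · intro P' hP'
      rw [Finset.mem_singleton.1 hP', Paradox, hP]
      exact hα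

/-- if κ4 fails, there is `c > 0` such that whenever κ1(n) and κ2(n) both
fail, `DP^max(n) ≥ c`. -/
theorem stmt_15 (p : ℕ) (hp : 1 ≤ p) (f : Judg p → Bool)
    (q : Fin (p + 1) → ℝ) (hq : ∀ i, q i ∈ Set.Icc (0 : ℝ) 1)
    (d : Fin (p + 1) → Bool) (D : Set (Judg p → ℝ)) (hne : D.Nonempty)
    (hcl : IsClosed D) (hsp : StrictlyPositive p D)
    (hdist : ∀ π ∈ D, IsDistribution p π) (hk4 : ¬ kappa4 p f q) :
    ∃ c > (0 : ℝ), ∀ n : ℕ, 1 ≤ n → ¬ kappa1 p n f q d → ¬ kappa2 p n f q d D →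
      c ≤ DPmax p n f q d D := by
  have key : ∀ α : Fin (p + 1) → Bool, ∃ c > (0 : ℝ), ¬ Consistent p f α →
      ∀ n : ℕ, (∃ π ∈ convexHull ℝ D, EffRef p n f q d π α) → c ≤ DPmax p n f q d D := by
    intro α
    by_cases hα : Consistent p f α
    · exact ⟨1, one_pos, fun h => absurd hα h⟩
    · obtain ⟨c, hc, h⟩ := exists_le_DPmax_of_not_consistent (d := d) hq hne hsp hdist hk4 hα
      exact ⟨c, hc, fun _ => h⟩
  choose c hc h using key
  obtain ⟨α₀, hα₀⟩ := Finite.exists_min c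
  refine ⟨c α₀, hc α₀, fun n _ _ h2 => ?_⟩
  simp only [kappa2, not_forall] at h2
  obtain ⟨π, hπ, α, hr, hα⟩ := h2
  exact (hα₀ α).trans (h α hα n ⟨π, hπ, hr⟩)

end
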